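/- Let 0 ≤ ε < I(X;Y), let W be independent of (X,Y), and α = ε/H(X). There exists a random variable U on 𝒰 such that I(U;X) = ε, H(Y|U,X,W) = 0, I(X;U|Y,W) ≤ α H(X|Y) + (1−α)(log(I(X;Y)+1)+4), and |𝒰| ≤ (|𝒳|(|𝒴|−1)+2)(|𝒳|+1). -/

import Mathlib

/-- Shannon entropy (base 2) of a finitely supported distribution given as a function. -/
noncomputable def ent {α : Type*} [Fintype α] (q : α → ℝ) : ℝ :=
  - ∑ a, q a * Real.logb 2 (q a)
open MeasureTheory

/-- the standard exponential law -/
noncomputable def nuE : Measure ℝ :=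
  (volume.restrict (Set.Ioi (0:ℝ))).withDensity (fun t => ENNReal.ofReal (Real.exp (-t)))

lemma lint_exp0 (r : ℝ) (hr : 0 < r) :
    ∫⁻ t in Set.Ioi (0:ℝ), ENNReal.ofReal (Real.exp (-(r * t))) = ENNReal.ofReal (1 / r) := by
  have h := Real.integral_rpow_mul_exp_neg_mul_Ioi (a := 1) (r := r) one_pos hr
  simp only [sub_self, Real.rpow_zero, one_mul, Real.rpow_one, Real.Gamma_one, mul_one] at h
  rw [← h, ofReal_integral_eq_lintegral_ofReal]
  · apply Integrable.of_integral_ne_zero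
    rw [h]; positivity
  · exact Filter.Eventually.of_forall fun t => (Real.exp_pos _).le

lemma lint_exp1 (r : ℝ) (hr : 0 < r) :
    ∫⁻ t in Set.Ioi (0:ℝ), ENNReal.ofReal (t * Real.exp (-(r * t))) = ENNReal.ofReal ((1 / r)^2) := by
  have h := Real.integral_rpow_mul_exp_neg_mul_Ioi (a := 2) (r := r) two_pos hr
  have e : (2:ℝ) - 1 = 1 := by norm_num
  simp only [e, Real.rpow_one, Real.rpow_two, Real.Gamma_two, mul_one] at h
  rw [← h, ofReal_integral_eq_lintegral_ofReal]
  · apply Integrable.of_integral_ne_zero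
    rw [h]; positivity
  · filter_upwards [ae_restrict_mem measurableSet_Ioi] with t ht
    exact mul_nonneg (le_of_lt ht) (Real.exp_pos _).le

lemma nuE_lint (φ : ℝ → ENNReal) (hφ : Measurable φ) :
    ∫⁻ t, φ t ∂nuE = ∫⁻ t in Set.Ioi (0:ℝ), φ t * ENNReal.ofReal (Real.exp (-t)) := by
  unfold nuE
  rw [lintegral_withDensity_eq_lintegral_mul _ (by fun_prop) hφ]
  simp [mul_comm]

lemma nuE_tail (s : ℝ) (hs : 0 ≤ s) : nuE (Set.Ioi s) = ENNReal.ofReal (Real.exp (-s)) := by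
  unfold nuE
  rw [withDensity_apply _ measurableSet_Ioi, Measure.restrict_restrict measurableSet_Ioi]
  have : Set.Ioi s ∩ Set.Ioi 0 = Set.Ioi s := by
    rw [Set.Ioi_inter_Ioi, max_eq_left hs]
  rw [this, ← integral_exp_neg_Ioi, ofReal_integral_eq_lintegral_ofReal]
  · apply Integrable.of_integral_ne_zero
    rw [integral_exp_neg_Ioi]; positivity
  · exact Filter.Eventually.of_forall fun t => (Real.exp_pos _).le

instance nuE_prob : IsProbabilityMeasure nuE := ⟨by
  unfold nuE
  rw [withDensity_apply _ MeasurableSet.univ, Measure.restrict_univ]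
  simpa using lint_exp0 1 one_pos⟩

lemma nuE_pos : ∀ᵐ t ∂nuE, 0 < t := by
  unfold nuE
  apply (withDensity_absolutelyContinuous _ _).ae_le
  exact ae_restrict_mem measurableSet_Ioi

lemma race {Y : Type*} [Fintype Y] [DecidableEq Y] (y : Y) (c : Y → ℝ) (hc : ∀ z, 0 ≤ c z)
    (φ : ℝ → ENNReal) (hφ : Measurable φ) :
    ∫⁻ v, Set.indicator {v : Y → ℝ | ∀ z, z ≠ y → c z * v y < v z} (fun v => φ (v y)) v
      ∂(Measure.pi fun _ : Y => nuE)
    = ∫⁻ t in Set.Ioi (0:ℝ), φ t *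
        ENNReal.ofReal (Real.exp (-((1 + ∑ z ∈ Finset.univ.erase y, c z) * t))) := by
  have hm : MeasurableSet {v : Y → ℝ | ∀ z, z ≠ y → c z * v y < v z} := by
    simp only [Set.ofPred_forall]
    refine MeasurableSet.iInter fun z => MeasurableSet.iInter fun _ => ?_
    exact measurableSet_lt (by fun_prop) (by fun_prop)
  have hm2 : Measurable (Set.indicator {v : Y → ℝ | ∀ z, z ≠ y → c z * v y < v z}
      (fun v => φ (v y))) := (hφ.comp (measurable_pi_apply y)).indicator hm
  rw [lintegral_eq_lmarginal_univ (fun _ => (0:ℝ)), lmarginal_erase _ hm2 (Finset.mem_univ y)]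
  have key : ∀ t : ℝ, 0 < t → (∫⋯∫⁻_Finset.univ.erase y,
      Set.indicator {v : Y → ℝ | ∀ z, z ≠ y → c z * v y < v z} (fun v => φ (v y))
      ∂(fun _ : Y => nuE)) (Function.update (fun _ => (0:ℝ)) y t)
      = φ t * ENNReal.ofReal (Real.exp (-((∑ z ∈ Finset.univ.erase y, c z) * t))) := by
    intro t ht
    unfold lmarginal
    have : ∀ w : (i : (Finset.univ.erase y : Finset Y)) → ℝ,
        Set.indicator {v : Y → ℝ | ∀ z, z ≠ y → c z * v y < v z} (fun v => φ (v y))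
          (Function.updateFinset (Function.update (fun _ => (0:ℝ)) y t) (Finset.univ.erase y) w)
        = Set.indicator (Set.pi Set.univ (fun i : (Finset.univ.erase y : Finset Y) =>
            Set.Ioi (c i * t))) (fun _ => φ t) w := by
      intro w
      have hy : Function.updateFinset (Function.update (fun _ => (0:ℝ)) y t)
          (Finset.univ.erase y) w y = t := by simp [Function.updateFinset]
      unfold Set.indicator
      beta_reduce
      rw [hy]
      congr 1
      simp only [Set.mem_ofPred_eq, Set.mem_pi, Set.mem_univ, true_implies, hy, Set.mem_Ioi,
        Subtype.forall, Finset.mem_erase, eq_iff_iff]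
      refine forall_congr' fun z => ⟨fun h hz => ?_, fun h hz => ?_⟩
      · simpa [Function.updateFinset, hz.1] using h hz.1
      · simpa [Function.updateFinset, hz] using h ⟨hz, Finset.mem_univ z⟩
    simp_rw [this]
    rw [lintegral_indicator (MeasurableSet.univ_pi fun _ => measurableSet_Ioi),
      setLIntegral_const, Measure.pi_pi]
    congr 1
    have h2 : ∀ i : (Finset.univ.erase y : Finset Y), nuE (Set.Ioi (c i * t))
        = ENNReal.ofReal (Real.exp (-(c i * t))) := fun i =>
      nuE_tail _ (mul_nonneg (hc _) ht.le)
    simp_rw [h2]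
    rw [← ENNReal.ofReal_prod_of_nonneg (fun _ _ => (Real.exp_pos _).le), ← Real.exp_sum,
      Finset.sum_mul, ← Finset.sum_neg_distrib]
    rw [← Finset.sum_coe_sort (Finset.univ.erase y) (fun z => -(c z * t))]
  rw [lintegral_congr_ae (g := fun t => φ t *
    ENNReal.ofReal (Real.exp (-((∑ z ∈ Finset.univ.erase y, c z) * t))))
    (by filter_upwards [nuE_pos] with t ht using key t ht)]
  rw [nuE_lint _ (by fun_prop)]
  refine lintegral_congr fun t => ?_
  rw [mul_assoc, ← ENNReal.ofReal_mul (Real.exp_pos _).le, ← Real.exp_add]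
  congr 4; ring

/-- the event that `y` wins the race with rates `P` -/
def Aev {Y : Type*} (P : Y → ℝ) (y : Y) : Set (Y → ℝ) :=
  {v | 0 < P y ∧ ∀ z, z ≠ y → P z / P y * v y < v z}

lemma Aev_meas {Y : Type*} [Fintype Y] (P : Y → ℝ) (y : Y) : MeasurableSet (Aev P y) := by
  unfold Aev
  by_cases h : 0 < P y
  · simp only [h, true_and, Set.ofPred_forall]
    refine MeasurableSet.iInter fun z => MeasurableSet.iInter fun _ => ?_
    exact measurableSet_lt (by fun_prop) (by fun_prop)
  · simp [h]

lemma Aev_disj {Y : Type*} (P : Y → ℝ) {y z : Y} {v : Y → ℝ} (h1 : v ∈ Aev P y)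
    (h2 : v ∈ Aev P z) : y = z := by
  by_contra hne
  have a := h1.2 z (Ne.symm hne)
  have b := h2.2 y hne
  have hy := h1.1
  have hz := h2.1
  rw [div_mul_eq_mul_div, div_lt_iff₀ hy] at a
  rw [div_mul_eq_mul_div, div_lt_iff₀ hz] at b
  linarith

lemma Aev_lint {Y : Type*} [Fintype Y] (P : Y → ℝ) (hP : ∀ y, 0 ≤ P y)
    (hP1 : ∑ y, P y = 1) (y : Y) (hy : 0 < P y) (φ : ℝ → ENNReal) (hφ : Measurable φ) :
    ∫⁻ v in Aev P y, φ (v y) ∂(Measure.pi fun _ : Y => nuE)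
    = ∫⁻ t in Set.Ioi (0:ℝ), φ t * ENNReal.ofReal (Real.exp (-((1 / P y) * t))) := by
  classical
  rw [← lintegral_indicator (Aev_meas P y)]
  have := race y (fun z => P z / P y) (fun z => div_nonneg (hP z) hy.le) φ hφ
  have e : (1 + ∑ z ∈ Finset.univ.erase y, P z / P y) = 1 / P y := by
    rw [← Finset.sum_div]
    have := Finset.add_sum_erase Finset.univ P (Finset.mem_univ y)
    rw [hP1] at this
    field_simp
    linarith
  rw [e] at this
  rw [← this]
  simp [Aev, hy]

lemma Aev_measure {Y : Type*} [Fintype Y] (P : Y → ℝ) (hP : ∀ y, 0 ≤ P y)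
    (hP1 : ∑ y, P y = 1) (y : Y) :
    (Measure.pi fun _ : Y => nuE) (Aev P y) = ENNReal.ofReal (P y) := by
  by_cases hy : 0 < P y
  · have := Aev_lint P hP hP1 y hy (fun _ => 1) measurable_const
    simp only [lintegral_const, one_mul] at this
    rw [lint_exp0 _ (by positivity)] at this
    simpa using this
  · have : P y = 0 := le_antisymm (not_lt.1 hy) (hP y)
    simp [Aev, this]

lemma Aev_mean {Y : Type*} [Fintype Y] (P : Y → ℝ) (hP : ∀ y, 0 ≤ P y)
    (hP1 : ∑ y, P y = 1) (y : Y) :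
    ∫⁻ v in Aev P y, ENNReal.ofReal (v y) ∂(Measure.pi fun _ : Y => nuE)
      = ENNReal.ofReal (P y ^ 2) := by
  by_cases hy : 0 < P y
  · rw [Aev_lint P hP hP1 y hy (fun t => ENNReal.ofReal t) (by fun_prop)]
    have := lint_exp1 (1 / P y) (by positivity)
    rw [one_div_one_div] at this
    rw [← this]
    refine setLIntegral_congr_fun measurableSet_Ioi fun t ht => ?_
    rw [ENNReal.ofReal_mul (le_of_lt ht)]
  · have : P y = 0 := le_antisymm (not_lt.1 hy) (hP y)
    simp [Aev, this]

lemma Aev_cover {Y : Type*} [Fintype Y] (P : Y → ℝ) (hP : ∀ y, 0 ≤ P y)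
    (hP1 : ∑ y, P y = 1) :
    ∀ᵐ v ∂(Measure.pi fun _ : Y => nuE), ∃ y, v ∈ Aev P y := by
  have h : (Measure.pi fun _ : Y => nuE) (⋃ y, Aev P y) = 1 := by
    rw [measure_iUnion (fun y z hyz => Set.disjoint_left.2 fun v h1 h2 => hyz (Aev_disj P h1 h2))
      (Aev_meas P), tsum_fintype]
    simp_rw [Aev_measure P hP hP1]
    rw [← ENNReal.ofReal_sum_of_nonneg (fun y _ => hP y), hP1, ENNReal.ofReal_one]
  have := (prob_compl_eq_zero_iff (MeasurableSet.iUnion (Aev_meas P))).2 h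
  filter_upwards [measure_eq_zero_iff_ae_notMem.1 this] with v hv
  simpa using hv

lemma pow_int (Q m : ℝ) (hQ : 0 < Q) (hm : 0 < m) :
    IntegrableOn (fun t : ℝ => (1 + t / Q) ^ (-(1 + 1 / m))) (Set.Ioi 0) ∧
    ∫ t in Set.Ioi (0:ℝ), (1 + t / Q) ^ (-(1 + 1 / m)) = Q * m := by
  have hd : ∀ t ∈ Set.Ici (0:ℝ), HasDerivAt (fun t : ℝ => -(Q * m) * (1 + t / Q) ^ (-(1 / m)))
      ((1 + t / Q) ^ (-(1 + 1 / m))) t := by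
    intro t ht
    have hpos : 0 < 1 + t / Q := by
      have : 0 ≤ t / Q := div_nonneg ht hQ.le
      linarith
    have h1 : HasDerivAt (fun t : ℝ => 1 + t / Q) (1 / Q) t :=
      ((hasDerivAt_id t).div_const Q).const_add 1
    have h2 := (h1.rpow_const (p := -(1 / m)) (Or.inl hpos.ne')).const_mul (-(Q * m))
    have e : (1 + t / Q) ^ (-(1 + 1 / m)) =
        -(Q * m) * (1 / Q * -(1 / m) * (1 + t / Q) ^ (-(1 / m) - 1)) := by
      rw [show -(1 + 1 / m) = -(1 / m) - 1 by ring]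
      generalize (1 + t / Q) ^ (-(1 / m) - 1) = K
      field_simp
    rw [e]
    exact h2
  have hn : ∀ t ∈ Set.Ioi (0:ℝ), 0 ≤ (1 + t / Q) ^ (-(1 + 1 / m)) := by
    intro t ht
    have : 0 ≤ t / Q := div_nonneg (le_of_lt ht) hQ.le
    positivity
  have ht : Filter.Tendsto (fun t : ℝ => -(Q * m) * (1 + t / Q) ^ (-(1 / m))) Filter.atTop
      (nhds 0) := by
    have h1 : Filter.Tendsto (fun t : ℝ => 1 + t / Q) Filter.atTop Filter.atTop :=
      Filter.tendsto_atTop_add_const_left _ _ (Filter.tendsto_id.atTop_div_const hQ)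
    have h2 := ((tendsto_rpow_neg_atTop (y := 1 / m) (by positivity)).comp h1).const_mul (-(Q * m))
    simpa using h2
  refine ⟨integrableOn_Ioi_deriv_of_nonneg' hd hn ht, ?_⟩
  rw [integral_Ioi_of_hasDerivAt_of_nonneg' hd hn ht]
  simp

lemma nuE_pow (Q m : ℝ) (hQ : 0 < Q) (hm : 0 < m) :
    Integrable (fun t : ℝ => (1 + t / Q) ^ (-(1 + 1 / m))) nuE ∧
    ∫ t, (1 + t / Q) ^ (-(1 + 1 / m)) ∂nuE ≤ Q * m := by
  have hle : ∫⁻ t, ENNReal.ofReal ((1 + t / Q) ^ (-(1 + 1 / m))) ∂nuE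
      ≤ ENNReal.ofReal (Q * m) := by
    rw [nuE_lint _ (by fun_prop), ← (pow_int Q m hQ hm).2,
      ofReal_integral_eq_lintegral_ofReal (pow_int Q m hQ hm).1]
    · refine setLIntegral_mono (by fun_prop) fun t ht => ?_
      refine mul_le_of_le_one_right (by positivity) ?_
      rw [ENNReal.ofReal_le_one]
      exact Real.exp_le_one_iff.2 (by simpa using le_of_lt ht)
    · filter_upwards [ae_restrict_mem measurableSet_Ioi] with t ht
      have : 0 ≤ t / Q := div_nonneg (le_of_lt ht) hQ.le
      simp only [Pi.zero_apply]
      positivity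
  have hnn : 0 ≤ᵐ[nuE] (fun t : ℝ => (1 + t / Q) ^ (-(1 + 1 / m))) := by
    filter_upwards [nuE_pos] with t ht
    simp only [Pi.zero_apply]
    positivity
  have hms : AEStronglyMeasurable (fun t : ℝ => (1 + t / Q) ^ (-(1 + 1 / m))) nuE := by
    apply Measurable.aestronglyMeasurable; fun_prop
  refine ⟨(lintegral_ofReal_ne_top_iff_integrable hms hnn).1
    (hle.trans_lt ENNReal.ofReal_lt_top).ne, ?_⟩
  rw [integral_eq_lintegral_of_nonneg_ae hnn hms]
  exact ENNReal.toReal_le_of_le_ofReal (by positivity) hle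

lemma logb_tan (a b : ℝ) (ha : 0 < a) (hb : 0 < b) :
    Real.logb 2 a ≤ Real.logb 2 b + (a / b - 1) / Real.log 2 := by
  have h2 : 0 < Real.log 2 := Real.log_pos (by norm_num)
  have := Real.log_le_sub_one_of_pos (div_pos ha hb)
  rw [Real.log_div ha.ne' hb.ne'] at this
  unfold Real.logb
  rw [← add_div]
  apply div_le_div_of_nonneg_right _ h2.le
  linarith

lemma sum_push {X Y : Type*} [Fintype X] [Fintype Y] [DecidableEq Y] (pX : X → ℝ) (f : X → Y)
    (φ : Y → ℝ) :
    ∑ y, (∑ x, pX x * (if f x = y then 1 else 0)) * φ y = ∑ x, pX x * φ (f x) := by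
  simp_rw [Finset.sum_mul]
  rw [Finset.sum_comm]
  refine Finset.sum_congr rfl fun x _ => ?_
  simp

lemma gibbs {X Y : Type*} [Fintype X] [Fintype Y] [DecidableEq Y] (pX : X → ℝ)
    (hpX : ∀ x, 0 ≤ pX x) (h1 : ∑ x, pX x = 1) (f : X → Y) (g : Y → ℝ) (hg : ∀ y, 0 ≤ g y)
    (hgf : ∀ x, 0 < g (f x)) (hZ : 0 < ∑ y, g y) :
    ent (fun y => ∑ x, pX x * (if f x = y then (1:ℝ) else 0)) ≤
      ∑ x, pX x * (- Real.logb 2 (g (f x))) + Real.logb 2 (∑ y, g y) := by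
  have h2 : 0 < Real.log 2 := Real.log_pos (by norm_num)
  set Z := ∑ y, g y with hZdef
  set s : Y → ℝ := fun y => ∑ x, pX x * (if f x = y then (1:ℝ) else 0) with hs
  have hs0 : ∀ y, 0 ≤ s y := fun y => Finset.sum_nonneg fun x _ =>
    mul_nonneg (hpX x) (by split_ifs <;> norm_num)
  have hs1 : ∑ y, s y = 1 := by
    have := sum_push pX f (fun _ => 1)
    simp only [mul_one] at this
    simp only [hs, this, h1]
  have hpush := sum_push pX f (fun y => - Real.logb 2 (g y))
  rw [← hpush]
  change ent s ≤ ∑ y, s y * (- Real.logb 2 (g y)) + Real.logb 2 Z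
  have hterm : ∀ y, -(s y * Real.logb 2 (s y)) ≤
      s y * (- Real.logb 2 (g y)) + s y * Real.logb 2 Z + (g y / Z - s y) / Real.log 2 := by
    intro y
    rcases (hs0 y).eq_or_lt with h | h
    · rw [← h]
      simp only [zero_mul, neg_zero, zero_add, sub_zero]
      exact div_nonneg (div_nonneg (hg y) hZ.le) h2.le
    · have hgy : 0 < g y := by
        rcases (hg y).eq_or_lt with h' | h'
        · exfalso
          have : s y = 0 := by
            simp only [hs]
            refine Finset.sum_eq_zero fun x _ => ?_
            rw [if_neg, mul_zero]
            intro e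
            have := hgf x
            rw [e, ← h'] at this
            exact lt_irrefl _ this
          linarith
        · exact h'
      have := logb_tan (g y / Z) (s y) (div_pos hgy hZ) h
      rw [Real.logb_div hgy.ne' hZ.ne'] at this
      have h3 := mul_le_mul_of_nonneg_left this h.le
      have e : s y * (Real.logb 2 (s y) + (g y / Z / s y - 1) / Real.log 2)
        = s y * Real.logb 2 (s y) + (g y / Z - s y) / Real.log 2 := by
        field_simp
      rw [e] at h3
      linarith
  have hsumm := Finset.sum_le_sum fun y (_ : y ∈ Finset.univ) => hterm y
  rw [Finset.sum_add_distrib, Finset.sum_add_distrib, ← Finset.sum_mul, hs1,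
    ← Finset.sum_div, Finset.sum_sub_distrib, hs1, ← Finset.sum_div, ← hZdef, div_self hZ.ne',
    Finset.sum_neg_distrib, sub_self, zero_div, one_mul, add_zero] at hsumm
  unfold ent
  linarith

lemma ind_mul_eq {Ω : Type*} (A : Set Ω) (φ : Ω → ℝ) (v : Ω) :
    A.indicator φ v = A.indicator (fun _ => (1:ℝ)) v * φ v := by
  unfold Set.indicator; split_ifs <;> simp

/-- random output law given the race vector -/
noncomputable def sv {X Y : Type*} [Fintype X] (pX : X → ℝ) (P : X → Y → ℝ) (v : Y → ℝ) (y : Y) :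
    ℝ := ∑ x, pX x * (Aev (P x) y).indicator (fun _ => (1:ℝ)) v

lemma hbar {X Y : Type*} [Fintype X] [Fintype Y] (pX : X → ℝ)
    (hpX : ∀ x, 0 ≤ pX x) (h1 : ∑ x, pX x = 1) (P : X → Y → ℝ) (hP : ∀ x y, 0 ≤ P x y)
    (hP1 : ∀ x, ∑ y, P x y = 1) (Q : Y → ℝ) (hQ : ∀ y, 0 ≤ Q y) (hQ1 : ∑ y, Q y = 1)
    (hPQ : ∀ x y, Q y = 0 → P x y = 0) (m : ℝ) (hm : 0 < m)
    (hintg : Integrable (fun v => ent (sv pX P v)) (Measure.pi fun _ : Y => nuE)) :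
    ∫ v, ent (sv pX P v) ∂(Measure.pi fun _ : Y => nuE) ≤
      (1 + 1 / m) * (∑ x, pX x * ∑ y, P x y * Real.logb 2 (1 + P x y / Q y)) + Real.logb 2 m := by
  classical
  have h2 : 0 < Real.log 2 := Real.log_pos (by norm_num)
  set μ := (Measure.pi fun _ : Y => nuE) with hμ
  set g : Y → (Y → ℝ) → ℝ := fun y v => if Q y = 0 then 0 else (1 + v y / Q y) ^ (-(1 + 1 / m))
    with hg
  set a : X → Y → ℝ := fun x y => Real.logb 2 (1 + P x y / Q y) +
    (1 / (1 + P x y / Q y) - 1) / Real.log 2 with ha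
  set b : X → Y → ℝ := fun x y => 1 / (Q y * (1 + P x y / Q y) * Real.log 2) with hb
  set B : (Y → ℝ) → ℝ := fun v => ∑ x, pX x * ∑ y, (1 + 1 / m) *
      ((Aev (P x) y).indicator (fun _ => (1:ℝ)) v * a x y +
       (Aev (P x) y).indicator (fun v => v y) v * b x y)
      + ((∑ y, g y v) * (1 / (m * Real.log 2)) + (Real.logb 2 m - 1 / Real.log 2)) with hB
  have hpos : ∀ᵐ v ∂μ, ∀ y, 0 < v y := by
    rw [ae_all_iff]
    intro y
    exact (measurePreserving_eval (fun _ : Y => nuE) y).quasiMeasurePreserving.ae nuE_pos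
  have hcov : ∀ᵐ v ∂μ, ∀ x, ∃ y, v ∈ Aev (P x) y := by
    rw [ae_all_iff]
    intro x
    exact Aev_cover (P x) (hP x) (hP1 x)
  have hle : (fun v => ent (sv pX P v)) ≤ᵐ[μ] B := by
    filter_upwards [hpos, hcov] with v hv hc
    choose f hf using hc
    have hind : ∀ x y, (Aev (P x) y).indicator (fun _ => (1:ℝ)) v = if f x = y then 1 else 0 := by
      intro x y
      unfold Set.indicator
      by_cases h : f x = y
      · subst h; rw [if_pos (hf x), if_pos rfl]
      · rw [if_neg h, if_neg (fun h' => h (Aev_disj _ (hf x) h'))]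
    have hQf : ∀ x, 0 < Q (f x) := by
      intro x
      refine (hQ _).lt_of_ne fun h => ?_
      have := (hf x).1
      rw [hPQ x _ h.symm] at this
      exact lt_irrefl _ this
    have hg0 : ∀ y, 0 ≤ g y v := by
      intro y
      simp only [hg]
      split_ifs with h
      · exact le_rfl
      · have : 0 ≤ v y / Q y := div_nonneg (hv y).le (hQ y)
        positivity
    have hgf : ∀ x, 0 < g (f x) v := by
      intro x
      simp only [hg]
      rw [if_neg (hQf x).ne']
      have : 0 ≤ v (f x) / Q (f x) := div_nonneg (hv _).le (hQ _)
      positivity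
    have hZ : 0 < ∑ y, g y v := by
      obtain ⟨x⟩ : Nonempty X := by
        by_contra h
        rw [not_nonempty_iff] at h
        simp at h1
      exact Finset.sum_pos' (fun y _ => hg0 y) ⟨f x, Finset.mem_univ _, hgf x⟩
    have hG := gibbs pX hpX h1 f (fun y => g y v) hg0 hgf hZ
    have hsv : sv pX P v = fun y => ∑ x, pX x * (if f x = y then (1:ℝ) else 0) := by
      funext y
      simp only [sv, hind]
    rw [hsv]
    refine hG.trans ?_
    simp only [hB]
    refine add_le_add ?_ ?_
    · refine Finset.sum_le_sum fun x _ => mul_le_mul_of_nonneg_left ?_ (hpX x)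
      have e : ∑ y, (1 + 1 / m) *
          ((Aev (P x) y).indicator (fun _ => (1:ℝ)) v * a x y +
          (Aev (P x) y).indicator (fun v => v y) v * b x y)
          = (1 + 1 / m) * (a x (f x) + v (f x) * b x (f x)) := by
        rw [Finset.sum_eq_single (f x)]
        · rw [ind_mul_eq (Aev (P x) (f x)) (fun v => v (f x)), hind, if_pos rfl]; ring
        · intro y _ hy
          rw [ind_mul_eq (Aev (P x) y) (fun v => v y), hind, if_neg (Ne.symm hy)]; ring
        · simp
      rw [e]
      simp only [hg]
      have h3 : 0 < 1 + v (f x) / Q (f x) := by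
        have : 0 ≤ v (f x) / Q (f x) := div_nonneg (hv _).le (hQ _)
        positivity
      have h4 : 0 < 1 + P x (f x) / Q (f x) := by
        have : 0 ≤ P x (f x) / Q (f x) := div_nonneg (hP _ _) (hQ _)
        positivity
      rw [if_neg (hQf x).ne', Real.logb_rpow_eq_mul_logb_of_pos h3, ← neg_mul, neg_neg]
      refine mul_le_mul_of_nonneg_left ?_ (by positivity)
      refine (logb_tan _ _ h3 h4).trans (le_of_eq ?_)
      simp only [ha, hb]
      have := hQf x
      field_simp
      ring
    · refine (logb_tan _ _ hZ hm).trans (le_of_eq ?_)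
      field_simp
      ring
  have hi1 : ∀ x y, Integrable (fun v => (Aev (P x) y).indicator (fun _ => (1:ℝ)) v) μ :=
    fun x y => (integrable_const (1:ℝ)).indicator (Aev_meas _ _)
  have hI1 : ∀ x y, ∫ v, (Aev (P x) y).indicator (fun _ => (1:ℝ)) v ∂μ = P x y := by
    intro x y
    rw [integral_indicator (Aev_meas _ _)]
    simp [Measure.real, hμ, Aev_measure (P x) (hP x) (hP1 x), hP x y]
  have hnn : ∀ x y, 0 ≤ᵐ[μ.restrict (Aev (P x) y)] (fun v : Y → ℝ => v y) := by
    intro x y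
    filter_upwards [ae_restrict_of_ae hpos] with v hv using (hv y).le
  have hi2' : ∀ x y, IntegrableOn (fun v : Y → ℝ => v y) (Aev (P x) y) μ := by
    intro x y
    refine (lintegral_ofReal_ne_top_iff_integrable (measurable_pi_apply y).aestronglyMeasurable (hnn x y)).1 ?_
    rw [Aev_mean (P x) (hP x) (hP1 x)]
    exact ENNReal.ofReal_ne_top
  have hi2 : ∀ x y, Integrable (fun v => (Aev (P x) y).indicator (fun v => v y) v) μ :=
    fun x y => (integrable_indicator_iff (Aev_meas _ _)).2 (hi2' x y)
  have hI2 : ∀ x y, ∫ v, (Aev (P x) y).indicator (fun v => v y) v ∂μ = P x y ^ 2 := by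
    intro x y
    rw [integral_indicator (Aev_meas _ _),
      integral_eq_lintegral_of_nonneg_ae (hnn x y)
        (measurable_pi_apply y).aestronglyMeasurable,
      Aev_mean (P x) (hP x) (hP1 x), ENNReal.toReal_ofReal (by positivity)]
  have hgi : ∀ y, Integrable (g y) μ ∧ ∫ v, g y v ∂μ ≤ Q y * m := by
    intro y
    simp only [hg]
    by_cases h : Q y = 0
    · simp [h]
    · simp only [if_neg h]
      have hQy := (hQ y).lt_of_ne' h
      have hmp := measurePreserving_eval (fun _ : Y => nuE) y
      obtain ⟨k1, k2⟩ := nuE_pow (Q y) m hQy hm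
      refine ⟨hmp.integrable_comp_of_integrable k1, ?_⟩
      refine le_trans (le_of_eq ?_) k2
      have := integral_map (μ := μ) hmp.measurable.aemeasurable
        (f := fun t : ℝ => (1 + t / Q y) ^ (-(1 + 1 / m)))
        (by apply Measurable.aestronglyMeasurable; fun_prop)
      rw [hmp.map_eq] at this
      exact this.symm
  have hii : ∀ x y, Integrable (fun v => (1 + 1 / m) *
      ((Aev (P x) y).indicator (fun _ => (1:ℝ)) v * a x y +
       (Aev (P x) y).indicator (fun v => v y) v * b x y)) μ := fun x y =>
    (((hi1 x y).mul_const _).add ((hi2 x y).mul_const _)).const_mul _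
  have hBi1 : Integrable (fun v => ∑ x, pX x * ∑ y, (1 + 1 / m) *
      ((Aev (P x) y).indicator (fun _ => (1:ℝ)) v * a x y +
       (Aev (P x) y).indicator (fun v => v y) v * b x y)) μ :=
    integrable_finsetSum _ fun x _ => (integrable_finsetSum _ fun y _ => hii x y).const_mul _
  have hgs : Integrable (fun v => ∑ y, g y v) μ := integrable_finsetSum _ fun y _ => (hgi y).1
  have hBi2 : Integrable (fun v => ((∑ y, g y v) * (1 / (m * Real.log 2)) +
      (Real.logb 2 m - 1 / Real.log 2))) μ := (hgs.mul_const _).add (integrable_const _)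
  have hBi : Integrable B μ := hBi1.add hBi2
  refine (integral_mono_ae hintg hBi hle).trans ?_
  simp only [hB]
  rw [integral_add hBi1 hBi2, integral_add (hgs.mul_const _) (integrable_const _),
    integral_mul_const, integral_finsetSum _ (fun y _ => (hgi y).1), integral_const]
  refine add_le_add (le_of_eq ?_) ?_
  · rw [integral_finsetSum _
      (fun x _ => (integrable_finsetSum _ fun y _ => hii x y).const_mul _), Finset.mul_sum]
    refine Finset.sum_congr rfl fun x _ => ?_
    rw [integral_const_mul, integral_finsetSum _ (fun y _ => hii x y)]
    rw [mul_left_comm (1 + 1 / m) (pX x)]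
    congr 1
    rw [Finset.mul_sum]
    refine Finset.sum_congr rfl fun y _ => ?_
    rw [integral_const_mul, integral_add ((hi1 x y).mul_const _) ((hi2 x y).mul_const _),
      integral_mul_const, integral_mul_const, hI1, hI2]
    congr 1
    by_cases h : Q y = 0
    · simp [hPQ x y h]
    · have h5 := (hQ y).lt_of_ne' h
      have h6 := hP x y
      simp only [ha, hb]
      have h7 : 0 < Q y + P x y := by linarith
      field_simp
      ring
  · have hs : ∑ y, ∫ v, g y v ∂μ ≤ m := by
      calc ∑ y, ∫ v, g y v ∂μ ≤ ∑ y, Q y * m := Finset.sum_le_sum fun y _ => (hgi y).2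
        _ = m := by rw [← Finset.sum_mul, hQ1, one_mul]
    have : (∑ y, ∫ v, g y v ∂μ) * (1 / (m * Real.log 2)) ≤ m * (1 / (m * Real.log 2)) :=
      mul_le_mul_of_nonneg_right hs (by positivity)
    have e : m * (1 / (m * Real.log 2)) = 1 / Real.log 2 := by field_simp
    rw [e] at this
    simp
    simp at this
    linarith

lemma div_bound {X Y : Type*} [Fintype X] [Fintype Y] (pX : X → ℝ)
    (hpX : ∀ x, 0 ≤ pX x) (h1 : ∑ x, pX x = 1) (P : X → Y → ℝ) (hP : ∀ x y, 0 ≤ P x y)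
    (hP1 : ∀ x, ∑ y, P x y = 1) (Q : Y → ℝ) (hQ : ∀ y, 0 ≤ Q y) (hQ1 : ∑ y, Q y = 1)
    (hPQ : ∀ x y, Q y = 0 → P x y = 0) :
    ∑ x, pX x * ∑ y, P x y * Real.logb 2 (1 + P x y / Q y) ≤
      ∑ x, pX x * ∑ y, P x y * Real.logb 2 (P x y / Q y) + 1 := by
  have h2 : 0 < Real.log 2 := Real.log_pos (by norm_num)
  have hx : ∀ x, ∑ y, P x y * Real.logb 2 (1 + P x y / Q y) ≤
      ∑ y, P x y * Real.logb 2 (P x y / Q y) + 1 := by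
    intro x
    have : ∀ y, P x y * Real.logb 2 (1 + P x y / Q y) ≤
      P x y * Real.logb 2 (P x y / Q y) + P x y + (Q y - P x y) / (2 * Real.log 2) := by
      intro y
      rcases (hP x y).eq_or_lt with h | h
      · rw [← h]
        have := hQ y
        simp; positivity
      · have hq : 0 < Q y := (hQ y).lt_of_ne' fun h' => by
          rw [hPQ x y h'] at h; exact lt_irrefl _ h
        have hr : 0 < P x y / Q y := div_pos h hq
        have t := logb_tan (1 + P x y / Q y) (2 * (P x y / Q y)) (by positivity) (by positivity)
        rw [Real.logb_mul two_ne_zero hr.ne', Real.logb_self_eq_one (by norm_num)] at t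
        refine (mul_le_mul_of_nonneg_left t h.le).trans (le_of_eq ?_)
        have : P x y * ((1 + P x y / Q y) / (2 * (P x y / Q y)) - 1) = (Q y - P x y) / 2 := by
          field_simp
          ring
        rw [mul_add, mul_add, ← mul_div_assoc, this]
        field_simp
        ring
    refine (Finset.sum_le_sum fun y _ => this y).trans (le_of_eq ?_)
    rw [Finset.sum_add_distrib, Finset.sum_add_distrib, hP1, ← Finset.sum_div,
      Finset.sum_sub_distrib, hP1, hQ1]
    simp
  calc _ ≤ ∑ x, pX x * (∑ y, P x y * Real.logb 2 (P x y / Q y) + 1) :=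
        Finset.sum_le_sum fun x _ => mul_le_mul_of_nonneg_left (hx x) (hpX x)
    _ = _ := by
        simp_rw [mul_add, mul_one]
        rw [Finset.sum_add_distrib, h1]

/-- data of a deterministic map in the Caratheodory argument -/
noncomputable def Gpt {X Y : Type*} [Fintype X] [Fintype Y] [DecidableEq Y] (pX : X → ℝ) (y0 : Y)
    (f : X → Y) : (X × {y : Y // y ≠ y0} → ℝ) × ℝ :=
  (fun z => if f z.1 = z.2 then 1 else 0,
    ent (fun y => ∑ x, pX x * (if f x = y then (1:ℝ) else 0)))

lemma carath {X Y : Type*} [Fintype X] [Fintype Y] [DecidableEq Y] (pX : X → ℝ)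
    (P : X → Y → ℝ) (hP : ∀ x y, 0 ≤ P x y) (hP1 : ∀ x, ∑ y, P x y = 1) (y0 : Y) :
    Integrable (fun v => ent (sv pX P v)) (Measure.pi fun _ : Y => nuE) ∧
    ∃ (k : ℕ) (ω : Fin k → ℝ) (f : Fin k → X → Y), (∀ i, 0 ≤ ω i) ∧ ∑ i, ω i = 1 ∧
      (∀ x y, ∑ i, ω i * (if f i x = y then 1 else 0) = P x y) ∧
      ∑ i, ω i * ent (fun y => ∑ x, pX x * (if f i x = y then (1:ℝ) else 0)) =
        ∫ v, ent (sv pX P v) ∂(Measure.pi fun _ : Y => nuE) ∧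
      k ≤ Fintype.card X * (Fintype.card Y - 1) + 2 := by
  set μ := (Measure.pi fun _ : Y => nuE) with hμ
  let Gv : (Y → ℝ) → (X × {y : Y // y ≠ y0} → ℝ) × ℝ := fun v =>
    (fun z => (Aev (P z.1) z.2).indicator (fun _ => (1:ℝ)) v, ent (sv pX P v))
  have hcov : ∀ᵐ v ∂μ, ∀ x, ∃ y, v ∈ Aev (P x) y := by
    rw [ae_all_iff]
    intro x
    exact Aev_cover (P x) (hP x) (hP1 x)
  have hrange : ∀ᵐ v ∂μ, Gv v ∈ Set.range (Gpt pX y0) := by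
    filter_upwards [hcov] with v hc
    choose f hf using hc
    have hind : ∀ x y, (Aev (P x) y).indicator (fun _ => (1:ℝ)) v = if f x = y then 1 else 0 := by
      intro x y
      unfold Set.indicator
      by_cases h : f x = y
      · subst h; rw [if_pos (hf x), if_pos rfl]
      · rw [if_neg h, if_neg (fun h' => h (Aev_disj _ (hf x) h'))]
    have hsv : sv pX P v = fun y => ∑ x, pX x * (if f x = y then (1:ℝ) else 0) := by
      funext y
      simp only [sv, hind]
    refine ⟨f, ?_⟩
    simp only [Gpt, Gv, hsv, hind]
  have hfin : (Set.range (Gpt pX y0)).Finite := Set.finite_range _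
  have him : ∀ x y, Measurable (fun v => (Aev (P x) y).indicator (fun _ => (1:ℝ)) v) :=
    fun x y => measurable_const.indicator (Aev_meas _ _)
  have hsm : ∀ y, Measurable (fun v => sv pX P v y) := by
    intro y
    unfold sv
    exact Finset.measurable_sum _ fun x _ => (him x y).const_mul _
  have hem : Measurable (fun v => ent (sv pX P v)) := by
    unfold ent
    refine (Finset.measurable_sum _ fun y _ => (hsm y).mul ?_).neg
    unfold Real.logb
    exact (Real.measurable_log.comp (hsm y)).div_const _
  have hGm : Measurable Gv := by
    refine Measurable.prodMk ?_ hem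
    exact measurable_pi_lambda _ fun z => him _ _
  have hGi : Integrable Gv μ := by
    obtain ⟨C, hC⟩ := hfin.isBounded.exists_norm_le
    refine Integrable.of_bound hGm.aestronglyMeasurable C ?_
    filter_upwards [hrange] with v hv using hC _ hv
  have hei : Integrable (fun v => ent (sv pX P v)) μ := hGi.snd
  refine ⟨hei, ?_⟩
  have hmem : ∫ v, Gv v ∂μ ∈ convexHull ℝ (Set.range (Gpt pX y0)) := by
    refine Convex.integral_mem (convex_convexHull _ _) (hfin.isClosed_convexHull ℝ) ?_ hGi
    filter_upwards [hrange] with v hv using subset_convexHull _ _ hv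
  obtain ⟨ι, _, z, w, hz, haff, hw, hw1, hwz⟩ := eq_pos_convex_span_of_mem_convexHull (𝕜 := ℝ) hmem
  have hcard : Fintype.card ι ≤ Fintype.card X * (Fintype.card Y - 1) + 2 := by
    have := haff.card_le_finrank_succ
    have h2 := Submodule.finrank_le (vectorSpan ℝ (Set.range z))
    rw [Module.finrank_prod, Module.finrank_fintype_fun_eq_card, Fintype.card_prod,
      Module.finrank_self] at h2
    have h3 : Fintype.card {y : Y // y ≠ y0} = Fintype.card Y - 1 := by
      simp
    rw [h3] at h2
    omega
  choose f hf using fun i => hz (Set.mem_range_self i)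
  have hfst : ∀ x y, y ≠ y0 → ∑ i, w i * (if f i x = y then 1 else 0) = P x y := by
    intro x y hy
    have h1 := congrArg (fun e => e.1 (x, ⟨y, hy⟩)) hwz
    beta_reduce at h1
    rw [fst_integral hGi, eval_integral] at h1
    · simp only [← hf, Gpt, Gv, Prod.fst_sum, Prod.smul_fst, Finset.sum_apply, Pi.smul_apply,
        smul_eq_mul] at h1
      rw [h1, integral_indicator (Aev_meas _ _)]
      simp [Measure.real, hμ, Aev_measure (P x) (hP x) (hP1 x), hP x y]
    · intro i
      exact (integrable_const (1:ℝ)).indicator (Aev_meas _ _)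
  have hsnd : ∑ i, w i * ent (fun y => ∑ x, pX x * (if f i x = y then (1:ℝ) else 0)) =
      ∫ v, ent (sv pX P v) ∂μ := by
    have h1 := congrArg (fun e => e.2) hwz
    beta_reduce at h1
    rw [snd_integral hGi] at h1
    simpa only [← hf, Gpt, Gv, Prod.snd_sum, Prod.smul_snd, smul_eq_mul] using h1
  have hall : ∀ x y, ∑ i, w i * (if f i x = y then 1 else 0) = P x y := by
    intro x y
    by_cases hy : y = y0
    · subst hy
      have e1 : ∑ y', ∑ i, w i * (if f i x = y' then (1:ℝ) else 0) = 1 := by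
        rw [Finset.sum_comm]
        simpa using hw1
      have e2 := hP1 x
      rw [← Finset.add_sum_erase _ _ (Finset.mem_univ y)] at e1 e2
      have e3 : ∑ y' ∈ Finset.univ.erase y, ∑ i, w i * (if f i x = y' then (1:ℝ) else 0)
          = ∑ y' ∈ Finset.univ.erase y, P x y' :=
        Finset.sum_congr rfl fun y' hy' => hfst x y' (Finset.ne_of_mem_erase hy')
      rw [e3] at e1
      linarith
    · exact hfst x y hy
  let e := Fintype.equivFin ι
  refine ⟨Fintype.card ι, fun i => w (e.symm i), fun i => f (e.symm i), fun i => (hw _).le,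
    ?_, ?_, ?_, hcard⟩
  · rw [← hw1]; exact Equiv.sum_comp e.symm w
  · intro x y
    rw [← hall x y]
    exact Equiv.sum_comp e.symm fun i => w i * (if f i x = y then 1 else 0)
  · rw [← hsnd]
    exact Equiv.sum_comp e.symm
      fun i => w i * ent (fun y => ∑ x, pX x * (if f i x = y then (1:ℝ) else 0))

lemma sfrl {X Y : Type*} [Fintype X] [Fintype Y] [DecidableEq Y]
    (p : X × Y → ℝ) (hpos : ∀ z, 0 ≤ p z) (hsum : ∑ z, p z = 1)
    (pX : X → ℝ) (hpX : ∀ x, pX x = ∑ y, p (x, y))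
    (pY : Y → ℝ) (hpY : ∀ y, pY y = ∑ x, p (x, y))
    (hI : 0 ≤ ent pX + ent pY - ent p) :
    ∃ (k : ℕ) (ω : Fin k → ℝ) (f : Fin k → X → Y), (∀ i, 0 ≤ ω i) ∧ ∑ i, ω i = 1 ∧
      (∀ x y, pX x * ∑ i, ω i * (if f i x = y then 1 else 0) = p (x, y)) ∧
      ∑ i, ω i * ent (fun y => ∑ x, pX x * (if f i x = y then (1:ℝ) else 0)) ≤
        (ent pX + ent pY - ent p) + Real.logb 2 ((ent pX + ent pY - ent p) + 1) + 4 ∧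
      k ≤ Fintype.card X * (Fintype.card Y - 1) + 2 := by
  have hX0 : ∀ x, 0 ≤ pX x := fun x => by rw [hpX]; exact Finset.sum_nonneg fun y _ => hpos _
  have hY0 : ∀ y, 0 ≤ pY y := fun y => by rw [hpY]; exact Finset.sum_nonneg fun x _ => hpos _
  have hX1 : ∑ x, pX x = 1 := by
    simp_rw [hpX]; rw [← hsum, Fintype.sum_prod_type]
  have hY1 : ∑ y, pY y = 1 := by
    simp_rw [hpY]; rw [← hsum, Fintype.sum_prod_type_right]
  have hpx0 : ∀ x, pX x = 0 → ∀ y, p (x, y) = 0 := by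
    intro x hx y
    rw [hpX, Finset.sum_eq_zero_iff_of_nonneg (fun y _ => hpos _)] at hx
    exact hx y (Finset.mem_univ _)
  have hpy0 : ∀ y, pY y = 0 → ∀ x, p (x, y) = 0 := by
    intro y hy x
    rw [hpY, Finset.sum_eq_zero_iff_of_nonneg (fun y _ => hpos _)] at hy
    exact hy x (Finset.mem_univ _)
  obtain ⟨y0⟩ : Nonempty Y := by
    by_contra h
    rw [not_nonempty_iff] at h
    simp at hsum
  set P : X → Y → ℝ := fun x y => if pX x = 0 then pY y else p (x, y) / pX x with hPdef
  have hP : ∀ x y, 0 ≤ P x y := by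
    intro x y
    simp only [hPdef]
    split_ifs
    · exact hY0 y
    · exact div_nonneg (hpos _) (hX0 _)
  have hP1 : ∀ x, ∑ y, P x y = 1 := by
    intro x
    simp only [hPdef]
    split_ifs with h
    · exact hY1
    · rw [← Finset.sum_div, ← hpX, div_self h]
  have hPp : ∀ x y, pX x * P x y = p (x, y) := by
    intro x y
    simp only [hPdef]
    split_ifs with h
    · rw [h, hpx0 x h, zero_mul]
    · field_simp
  have hPQ : ∀ x y, pY y = 0 → P x y = 0 := by
    intro x y h
    simp only [hPdef]
    split_ifs
    · exact h
    · rw [hpy0 y h, zero_div]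
  obtain ⟨hintg, k, ω, f, h1, h2, h3, h4, h5⟩ := carath pX P hP hP1 y0
  refine ⟨k, ω, f, h1, h2, ?_, ?_, h5⟩
  · intro x y
    rw [h3, hPp]
  rw [h4]
  set I := ent pX + ent pY - ent p with hIdef
  have hII : ∑ x, pX x * ∑ y, P x y * Real.logb 2 (P x y / pY y) = I := by
    have t : ∀ x y, pX x * (P x y * Real.logb 2 (P x y / pY y)) =
        p (x, y) * Real.logb 2 (p (x, y)) - p (x, y) * Real.logb 2 (pX x)
          - p (x, y) * Real.logb 2 (pY y) := by
      intro x y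
      rw [← mul_assoc, hPp]
      by_cases h : p (x, y) = 0
      · simp [h]
      · have hx : pX x ≠ 0 := fun h' => h (hpx0 x h' y)
        have hy : pY y ≠ 0 := fun h' => h (hpy0 y h' x)
        simp only [hPdef, if_neg hx]
        rw [Real.logb_div (div_ne_zero h hx) hy, Real.logb_div h hx]
        ring
    simp_rw [Finset.mul_sum, t, Finset.sum_sub_distrib]
    have a1 : ∑ x, ∑ y, p (x, y) * Real.logb 2 (pX x) = - ent pX := by
      simp_rw [← Finset.sum_mul, ← hpX]
      simp [ent]
    have a2 : ∑ x, ∑ y, p (x, y) * Real.logb 2 (pY y) = - ent pY := by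
      rw [Finset.sum_comm]
      simp_rw [← Finset.sum_mul, ← hpY]
      simp [ent]
    have a3 : ∑ x, ∑ y, p (x, y) * Real.logb 2 (p (x, y)) = - ent p := by
      simp [ent, Fintype.sum_prod_type]
    rw [a1, a2, a3, hIdef]
    ring
  have hb := hbar pX hX0 hX1 P hP hP1 pY hY0 hY1 hPQ (I + 1) (by linarith) hintg
  have hd := div_bound pX hX0 hX1 P hP hP1 pY hY0 hY1 hPQ
  rw [hII] at hd
  have hm : 0 < I + 1 := by linarith
  have : (1 + 1 / (I + 1)) * (∑ x, pX x * ∑ y, P x y * Real.logb 2 (1 + P x y / pY y))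
      ≤ (1 + 1 / (I + 1)) * (I + 1) := mul_le_mul_of_nonneg_left hd (by positivity)
  have e : (1 + 1 / (I + 1)) * (I + 1) = I + 2 := by field_simp; ring
  linarith

lemma ent_equiv {A B : Type*} [Fintype A] [Fintype B] (e : A ≃ B) (q : A → ℝ) (r : B → ℝ)
    (h : ∀ a, q a = r (e a)) : ent q = ent r := by
  unfold ent
  rw [← Equiv.sum_comp e]
  simp_rw [h]

lemma eta_mul (a b : ℝ) : (a * b) * Real.logb 2 (a * b) =
    b * (a * Real.logb 2 a) + a * (b * Real.logb 2 b) := by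
  by_cases ha : a = 0
  · simp [ha]
  by_cases hb : b = 0
  · simp [hb]
  rw [Real.logb_mul ha hb]; ring

lemma ent_chain {A B : Type*} [Fintype A] [Fintype B] (r : A → ℝ) (c : A → B → ℝ)
    (hc : ∀ a, ∑ b, c a b = 1) :
    ent (fun z : A × B => r z.1 * c z.1 z.2) = ent r + ∑ a, r a * ent (c a) := by
  unfold ent
  rw [Fintype.sum_prod_type]
  simp_rw [eta_mul, Finset.sum_add_distrib, ← Finset.sum_mul, hc, ← Finset.mul_sum, mul_neg,
    Finset.sum_neg_distrib]
  ring

lemma ent_indep {A B : Type*} [Fintype A] [Fintype B] (r : A → ℝ) (c : B → ℝ)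
    (hr : ∑ a, r a = 1) (hc : ∑ b, c b = 1) :
    ent (fun z : A × B => r z.1 * c z.2) = ent r + ent c := by
  have := ent_chain r (fun _ => c) (fun _ => hc)
  rw [this, ← Finset.sum_mul, hr, one_mul]

lemma ent_delta {B : Type*} [Fintype B] [DecidableEq B] (b0 : B) :
    ent (fun b => if b0 = b then (1:ℝ) else 0) = 0 := by
  unfold ent
  simp

/-- erasure channel -/
noncomputable def Kch {X : Type*} [DecidableEq X] (α : ℝ) (x : X) : Option X → ℝ
  | none => 1 - α
  | some x' => if x' = x then α else 0

/-- output law of the erasure channel -/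
noncomputable def kout {X : Type*} (α : ℝ) (pX : X → ℝ) : Option X → ℝ
  | none => 1 - α
  | some x' => α * pX x'

/-- law of `Y` given the two parts of `U` -/
noncomputable def cnd {X Y : Type*} [Fintype X] [DecidableEq Y] (pX : X → ℝ) (f : X → Y) :
    Option X → Y → ℝ
  | none => fun y => ∑ x, pX x * (if f x = y then (1:ℝ) else 0)
  | some x' => fun y => if f x' = y then (1:ℝ) else 0

lemma ent_Kch {X : Type*} [Fintype X] [DecidableEq X] (α : ℝ) (x : X) :
    ent (Kch α x) = -((1 - α) * Real.logb 2 (1 - α)) - α * Real.logb 2 α := by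
  unfold ent
  rw [Fintype.sum_option]
  simp [Kch]
  ring

lemma ent_kout {X : Type*} [Fintype X] (α : ℝ) (pX : X → ℝ) (h1 : ∑ x, pX x = 1) :
    ent (kout α pX) = -((1 - α) * Real.logb 2 (1 - α)) - α * Real.logb 2 α + α * ent pX := by
  unfold ent
  rw [Fintype.sum_option]
  simp only [kout, eta_mul, Finset.sum_add_distrib, ← Finset.sum_mul, h1, ← Finset.mul_sum]
  ring

lemma Kch_sum {X : Type*} [Fintype X] [DecidableEq X] (α : ℝ) (x : X) :
    ∑ j, Kch α x j = 1 := by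
  rw [Fintype.sum_option]; simp [Kch]

lemma kout_sum {X : Type*} [Fintype X] (α : ℝ) (pX : X → ℝ) (h1 : ∑ x, pX x = 1) :
    ∑ j, kout α pX j = 1 := by
  rw [Fintype.sum_option]; simp [kout, ← Finset.mul_sum, h1]

lemma cnd_sum {X Y : Type*} [Fintype X] [Fintype Y] [DecidableEq Y] (pX : X → ℝ)
    (h1 : ∑ x, pX x = 1) (f : X → Y) (j : Option X) : ∑ y, cnd pX f j y = 1 := by
  cases j with
  | none =>
    simp only [cnd]
    rw [Finset.sum_comm]; simpa using h1
  | some x => simp [cnd]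

lemma kc_sum {X Y : Type*} [Fintype X] [DecidableEq X] [Fintype Y] [DecidableEq Y] (α : ℝ)
    (pX : X → ℝ) (f : X → Y) (j : Option X) (y : Y) :
    ∑ x, pX x * ((if f x = y then (1:ℝ) else 0) * Kch α x j) = kout α pX j * cnd pX f j y := by
  cases j with
  | none =>
    simp only [cnd, Kch, kout]
    rw [Finset.mul_sum]
    exact Finset.sum_congr rfl fun x _ => by ring
  | some x' =>
    simp only [cnd, Kch, kout]
    rw [Finset.sum_eq_single x']
    · simp [mul_comm]
    · intro x _ hx
      rw [if_neg (Ne.symm hx)]; ring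
    · simp

lemma kx_sum {X : Type*} [Fintype X] [DecidableEq X] (α : ℝ)
    (pX : X → ℝ) (h1 : ∑ x, pX x = 1) (j : Option X) :
    ∑ x, pX x * Kch α x j = kout α pX j := by
  cases j with
  | none =>
    simp only [Kch, kout]
    rw [← Finset.sum_mul, h1, one_mul]
  | some x' =>
    simp [Kch, kout, mul_comm]

lemma condent_nonneg {X Y : Type*} [Fintype X] [Fintype Y] (p : X × Y → ℝ) (hpos : ∀ z, 0 ≤ p z)
    (pY : Y → ℝ) (hpY : ∀ y, pY y = ∑ x, p (x, y)) : ent pY ≤ ent p := by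
  unfold ent
  rw [Fintype.sum_prod_type_right]
  refine neg_le_neg (Finset.sum_le_sum fun y _ => ?_)
  conv_rhs => rw [hpY, Finset.sum_mul, ← hpY]
  refine Finset.sum_le_sum fun x _ => ?_
  rcases (hpos (x, y)).eq_or_lt with h | h
  · simp [← h]
  · refine mul_le_mul_of_nonneg_left (Real.logb_le_logb_of_le (by norm_num) h ?_) h.le
    rw [hpY]
    exact Finset.single_le_sum (f := fun x => p (x, y)) (fun x _ => hpos _) (Finset.mem_univ x)

/-- Modified Extended Strong Functional Representation Lemma including the shared key `W`:
for `0 ≤ ε < I(X;Y)`, `W ⊥ (X,Y)` and `α = ε/H(X)`, there exists `U` with `I(U;X) = ε`,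
`H(Y|U,X,W) = 0`, `I(X;U|Y,W) ≤ α H(X|Y) + (1−α)(log(I(X;Y)+1)+4)` and
`|𝒰| ≤ (|𝒳|(|𝒴|−1)+2)(|𝒳|+1)`. -/
theorem stmt11 {X Y W : Type*} [Fintype X] [Fintype Y] [Fintype W]
    (p : X × Y → ℝ) (hpos : ∀ z, 0 ≤ p z) (hsum : ∑ z, p z = 1)
    (pX : X → ℝ) (hpX : ∀ x, pX x = ∑ y, p (x, y))
    (pY : Y → ℝ) (hpY : ∀ y, pY y = ∑ x, p (x, y))
    (pW : W → ℝ) (hpWpos : ∀ w, 0 ≤ pW w) (hpW1 : ∑ w, pW w = 1)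
    (ε α : ℝ) (hε0 : 0 ≤ ε)
    -- ε < I(X;Y)
    (hεI : ε < ent pX + ent pY - ent p)
    (hHX : 0 < ent pX) (hα : α = ε / ent pX) :
    ∃ (n : ℕ) (q : X × Y × W × Fin n → ℝ),
      (∀ z, 0 ≤ q z) ∧ (∑ z, q z = 1) ∧
      -- consistency: (X,Y) ∼ P_{XY} and W independent of (X,Y)
      (∀ x y w, (∑ u, q (x, y, w, u)) = p (x, y) * pW w) ∧
      -- I(U;X) = ε
      (ent (fun u => ∑ x, ∑ y, ∑ w, q (x, y, w, u))
        + ent pX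
        - ent (fun xu : X × Fin n => ∑ y, ∑ w, q (xu.1, y, w, xu.2)) = ε) ∧
      -- H(Y|U,X,W) = 0
      (ent q - ent (fun xwu : X × W × Fin n => ∑ y, q (xwu.1, y, xwu.2.1, xwu.2.2)) = 0) ∧
      -- I(X;U|Y,W) ≤ α H(X|Y) + (1−α)(log(I(X;Y)+1)+4)
      (ent (fun xyw : X × Y × W => ∑ u, q (xyw.1, xyw.2.1, xyw.2.2, u))
        + ent (fun ywu : Y × W × Fin n => ∑ x, q (x, ywu.1, ywu.2.1, ywu.2.2))
        - ent (fun yw : Y × W => ∑ x, ∑ u, q (x, yw.1, yw.2, u))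
        - ent q
        ≤ α * (ent p - ent pY)
          + (1 - α) * (Real.logb 2 ((ent pX + ent pY - ent p) + 1) + 4)) ∧
      n ≤ (Fintype.card X * (Fintype.card Y - 1) + 2) * (Fintype.card X + 1) := by
  classical
  set A := ent pX with hA
  have hcn : ent pY ≤ ent p := condent_nonneg p hpos pY hpY
  have hα0 : 0 ≤ α := by rw [hα]; positivity
  have hα1 : α ≤ 1 := by rw [hα, div_le_one hHX]; linarith
  have hX0 : ∀ x, 0 ≤ pX x := fun x => by rw [hpX]; exact Finset.sum_nonneg fun y _ => hpos _
  have hX1 : ∑ x, pX x = 1 := by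
    simp_rw [hpX]; rw [← hsum, Fintype.sum_prod_type]
  have hY1 : ∑ y, pY y = 1 := by
    simp_rw [hpY]; rw [← hsum, Fintype.sum_prod_type_right]
  obtain ⟨k, ω, f, hω0, hω1, hcons, hbound, hk⟩ :=
    sfrl p hpos hsum pX hpX pY hpY (by linarith)
  let e : Fin (Fintype.card (Fin k × Option X)) ≃ Fin k × Option X := (Fintype.equivFin _).symm
  let q : X × Y × W × Fin (Fintype.card (Fin k × Option X)) → ℝ := fun z =>
    pW z.2.2.1 * (ω (e z.2.2.2).1 *
      (pX z.1 * ((if f (e z.2.2.2).1 z.1 = z.2.1 then (1:ℝ) else 0) * Kch α z.1 (e z.2.2.2).2)))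
  have hK0 : ∀ (x : X) j, 0 ≤ Kch α x j := by
    intro x j
    cases j with
    | none => simp only [Kch]; linarith
    | some x' => simp only [Kch]; split_ifs; exacts [hα0, le_rfl]
  have hq0 : ∀ z, 0 ≤ q z := by
    intro z
    refine mul_nonneg (hpWpos _) (mul_nonneg (hω0 _) (mul_nonneg (hX0 _) (mul_nonneg ?_ (hK0 _ _))))
    split_ifs <;> norm_num
  have M1 : ∀ x y w, ∑ u, q (x, y, w, u) = p (x, y) * pW w := by
    intro x y w
    simp only [q]
    rw [Equiv.sum_comp e (fun ij => pW w * (ω ij.1 *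
      (pX x * ((if f ij.1 x = y then (1:ℝ) else 0) * Kch α x ij.2)))), Fintype.sum_prod_type]
    have (i : Fin k) : ∑ j, pW w * (ω i *
        (pX x * ((if f i x = y then (1:ℝ) else 0) * Kch α x j)))
        = pW w * pX x * (ω i * (if f i x = y then (1:ℝ) else 0)) := by
      rw [← Finset.mul_sum, ← Finset.mul_sum, ← Finset.mul_sum, ← Finset.mul_sum, Kch_sum]
      ring
    rw [Finset.sum_congr rfl fun i _ => this i, ← Finset.mul_sum, mul_assoc, hcons, mul_comm]
  have M2 : ∀ x w u, ∑ y, q (x, y, w, u) =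
      pW w * (ω (e u).1 * (pX x * Kch α x (e u).2)) := by
    intro x w u
    simp only [q]
    simp_rw [← Finset.mul_sum, ← Finset.sum_mul]
    simp
  have M3 : ∀ y w u, ∑ x, q (x, y, w, u) =
      pW w * (ω (e u).1 * (kout α pX (e u).2 * cnd pX (f (e u).1) (e u).2 y)) := by
    intro y w u
    simp only [q]
    simp_rw [← Finset.mul_sum]
    rw [kc_sum]
  have M5 : ∀ x u, ∑ y, ∑ w, q (x, y, w, u) = ω (e u).1 * (pX x * Kch α x (e u).2) := by
    intro x u
    rw [Finset.sum_comm]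
    simp_rw [M2]
    rw [← Finset.sum_mul, hpW1, one_mul]
  have M4 : ∀ u, ∑ x, ∑ y, ∑ w, q (x, y, w, u) = ω (e u).1 * kout α pX (e u).2 := by
    intro u
    simp_rw [M5]
    rw [← Finset.mul_sum, kx_sum α pX hX1]
  have M6 : ∀ y w, ∑ x, ∑ u, q (x, y, w, u) = pY y * pW w := by
    intro y w
    simp_rw [M1]
    rw [← Finset.sum_mul, ← hpY]
  have hq1 : ∑ z, q z = 1 := by
    simp_rw [Fintype.sum_prod_type, M1, ← Finset.mul_sum, hpW1, mul_one]
    rw [← hsum, Fintype.sum_prod_type]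
  set b := -((1 - α) * Real.logb 2 (1 - α)) - α * Real.logb 2 α with hb
  -- the entropies
  have E4 : ent (fun u => ∑ x, ∑ y, ∑ w, q (x, y, w, u)) = ent ω + (b + α * A) := by
    simp_rw [M4]
    rw [ent_equiv e _ (fun ij : Fin k × Option X => ω ij.1 * kout α pX ij.2) (fun _ => rfl),
      ent_indep _ _ hω1 (kout_sum α pX hX1), ent_kout α pX hX1]
  have hXK : ent (fun z : X × Option X => pX z.1 * Kch α z.1 z.2) = A + b := by
    rw [ent_chain pX (Kch α) (Kch_sum α)]
    simp_rw [ent_Kch]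
    rw [← Finset.sum_mul, hX1, one_mul]
  have hXK1 : ∑ z : X × Option X, pX z.1 * Kch α z.1 z.2 = 1 := by
    rw [Fintype.sum_prod_type]
    simp_rw [← Finset.mul_sum, Kch_sum, mul_one, hX1]
  have hωXK := ent_indep ω _ hω1 hXK1
  have hωXK1 : ∑ z : Fin k × (X × Option X), ω z.1 * (pX z.2.1 * Kch α z.2.1 z.2.2) = 1 := by
    rw [Fintype.sum_prod_type]
    have (i : Fin k) : ∑ z : X × Option X, ω i * (pX z.1 * Kch α z.1 z.2) = ω i := by
      rw [← Finset.mul_sum, hXK1, mul_one]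
    rw [← hω1]
    exact Finset.sum_congr rfl fun i _ => this i
  have E5 : ent (fun xu : X × Fin (Fintype.card (Fin k × Option X)) =>
      ∑ y, ∑ w, q (xu.1, y, w, xu.2)) = ent ω + (A + b) := by
    simp_rw [M5]
    rw [← hXK, ← hωXK]
    exact ent_equiv
      ⟨fun z => ((e z.2).1, (z.1, (e z.2).2)), fun z => (z.2.1, e.symm (z.1, z.2.2)),
        fun z => by simp, fun z => by simp⟩ _ _ (fun _ => rfl)
  have E2 : ent (fun xwu : X × W × Fin (Fintype.card (Fin k × Option X)) =>
      ∑ y, q (xwu.1, y, xwu.2.1, xwu.2.2)) = ent pW + (ent ω + (A + b)) := by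
    simp_rw [M2]
    rw [← hXK, ← hωXK, ← ent_indep pW _ hpW1 hωXK1]
    exact ent_equiv
      ⟨fun z => (z.2.1, ((e z.2.2).1, (z.1, (e z.2.2).2))),
        fun z => (z.2.2.1, z.1, e.symm (z.2.1, z.2.2.2)),
        fun z => by simp, fun z => by simp⟩ _ _ (fun _ => rfl)
  have Eq : ent q = ent (fun xwu : X × W × Fin (Fintype.card (Fin k × Option X)) =>
      ∑ y, q (xwu.1, y, xwu.2.1, xwu.2.2)) := by
    have hc := ent_chain (fun xwu : X × W × Fin (Fintype.card (Fin k × Option X)) =>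
        ∑ y, q (xwu.1, y, xwu.2.1, xwu.2.2))
      (fun xwu y => if f (e xwu.2.2).1 xwu.1 = y then (1:ℝ) else 0) (fun _ => by simp)
    simp_rw [ent_delta, mul_zero, Finset.sum_const_zero, add_zero] at hc
    rw [← hc]
    refine ent_equiv
      ⟨fun z => ((z.1, z.2.2.1, z.2.2.2), z.2.1), fun z => (z.1.1, z.2, z.1.2.1, z.1.2.2),
        fun z => rfl, fun z => rfl⟩ _ _ ?_
    rintro ⟨x, y, w, u⟩
    simp only [Equiv.coe_fn_mk, M2, q]
    ring
  have E1 : ent (fun xyw : X × Y × W => ∑ u, q (xyw.1, xyw.2.1, xyw.2.2, u))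
      = ent p + ent pW := by
    simp_rw [M1]
    rw [← ent_indep p pW hsum hpW1]
    exact ent_equiv (Equiv.prodAssoc X Y W).symm _ _ (fun _ => rfl)
  have E6 : ent (fun yw : Y × W => ∑ x, ∑ u, q (x, yw.1, yw.2, u)) = ent pY + ent pW := by
    simp_rw [M6]
    exact ent_indep pY pW hY1 hpW1
  set h : Fin k → ℝ := fun i => ent (fun y => ∑ x, pX x * (if f i x = y then (1:ℝ) else 0))
    with hh
  have hkc : ∀ i, ent (fun z : Option X × Y => kout α pX z.1 * cnd pX (f i) z.1 z.2)
      = b + α * A + (1 - α) * h i := by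
    intro i
    rw [ent_chain _ _ (cnd_sum pX hX1 (f i)), ent_kout α pX hX1, Fintype.sum_option]
    simp only [cnd, ent_delta, kout, mul_zero, Finset.sum_const_zero, add_zero, hh, hb, hA]
  have hkc1 : ∀ i, ∑ z : Option X × Y, kout α pX z.1 * cnd pX (f i) z.1 z.2 = 1 := by
    intro i
    rw [Fintype.sum_prod_type]
    simp_rw [← Finset.mul_sum, cnd_sum pX hX1, mul_one, kout_sum α pX hX1]
  have hωkc : ent (fun z : Fin k × (Option X × Y) =>
      ω z.1 * (kout α pX z.2.1 * cnd pX (f z.1) z.2.1 z.2.2))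
      = ent ω + (b + α * A + (1 - α) * ∑ i, ω i * h i) := by
    rw [ent_chain ω (fun i (z : Option X × Y) => kout α pX z.1 * cnd pX (f i) z.1 z.2) hkc1]
    simp_rw [hkc, mul_add, Finset.sum_add_distrib, ← Finset.sum_mul, hω1, Finset.mul_sum]
    congr 1
    rw [one_mul, one_mul]
    congr 1
    exact Finset.sum_congr rfl fun i _ => by ring
  have hωkc1 : ∑ z : Fin k × (Option X × Y),
      ω z.1 * (kout α pX z.2.1 * cnd pX (f z.1) z.2.1 z.2.2) = 1 := by
    rw [Fintype.sum_prod_type]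
    have (i : Fin k) : ∑ z : Option X × Y,
        ω i * (kout α pX z.1 * cnd pX (f i) z.1 z.2) = ω i := by
      rw [← Finset.mul_sum, hkc1, mul_one]
    rw [← hω1]
    exact Finset.sum_congr rfl fun i _ => this i
  have E3 : ent (fun ywu : Y × W × Fin (Fintype.card (Fin k × Option X)) =>
      ∑ x, q (x, ywu.1, ywu.2.1, ywu.2.2))
      = ent pW + (ent ω + (b + α * A + (1 - α) * ∑ i, ω i * h i)) := by
    simp_rw [M3]
    rw [← hωkc, ← ent_indep pW _ hpW1 hωkc1]
    exact ent_equiv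
      ⟨fun z => (z.2.1, ((e z.2.2).1, ((e z.2.2).2, z.1))),
        fun z => (z.2.2.2, z.1, e.symm (z.2.1, z.2.2.1)),
        fun z => by simp, fun z => by simp⟩ _ _ (fun _ => rfl)
  refine ⟨_, q, hq0, hq1, M1, ?_, ?_, ?_, ?_⟩
  · rw [E4, E5]
    have : α * A = ε := by rw [hα]; field_simp
    linarith
  · rw [Eq, sub_self]
  · rw [E1, E3, E6, Eq, E2]
    have := mul_le_mul_of_nonneg_left hbound (sub_nonneg.2 hα1)
    nlinarith
  · rw [Fintype.card_prod, Fintype.card_option, Fintype.card_fin]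
    exact Nat.mul_le_mul_right _ hk
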